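/- Let G be a graph, let A_G ⊂ ZV be the set of integer vectors expressible as nonnegative rational combinations of edge vectors of G. Then A_G is generated as an additive monoid by the edge vectors together with the vectors H = characteristic vector of the vertex set of an exceptional pair (two vertex-disjoint induced odd cycles, with no edge of G between them, lying in the same connected component). -/

import Mathlib

/-- The vertex following position `i` in the cyclic order of the list `l`. -/
def cnext {V : Type*} (l : List V) (i : Fin l.length) : V :=
  l.get ⟨((i : ℕ) + 1) % l.length,
    Nat.mod_lt _ (Nat.lt_of_le_of_lt (Nat.zero_le _) i.isLt)⟩

/-- A closed walk in the graph `G` (loops allowed), given as a nonempty list of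
vertices in cyclic order. -/
def IsClosedWalk {V : Type*} (G : V → V → Prop) (l : List V) : Prop :=
  l ≠ [] ∧ ∀ i : Fin l.length, G (l.get i) (cnext l i)

/-- The image in `ℤV` of the edge `{x, y}` (a loop at `x` if `x = y`, giving `2x`). -/
def eVec {V : Type*} [DecidableEq V] (x y : V) : V → ℤ :=
  fun v => (if v = x then 1 else 0) + (if v = y then 1 else 0)

/-- The image in `ℚV` of the edge `{x, y}`. -/
def eVecQ {V : Type*} [DecidableEq V] (x y : V) : V → ℚ :=
  fun v => (if v = x then 1 else 0) + (if v = y then 1 else 0)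

/-- The characteristic vector (in `ℤV`) of the vertices occurring in a list. -/
def ind {V : Type*} [DecidableEq V] (l : List V) : V → ℤ :=
  fun v => if v ∈ l then 1 else 0

/-- Reachability in the graph `G` (connected components). -/
def Reach {V : Type*} (G : V → V → Prop) : V → V → Prop :=
  Relation.ReflTransGen (fun a b => G a b ∨ G b a)

/-- An induced cycle of `G`: a circuit such that the only adjacencies of `G` among its
vertices are the consecutive ones. -/
def IsInducedCycle {V : Type*} (G : V → V → Prop) (l : List V) : Prop :=
  IsClosedWalk G l ∧ l.Nodup ∧
    ∀ x ∈ l, ∀ y ∈ l, G x y →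
      ∃ i : Fin l.length, (x = l.get i ∧ y = cnext l i) ∨ (y = l.get i ∧ x = cnext l i)

/-- An exceptional pair: two vertex-disjoint induced odd cycles (possibly loops), with
no edge of `G` between them, lying in the same connected component of `G`. -/
def ExcPair {V : Type*} (G : V → V → Prop) (l1 l2 : List V) : Prop :=
  IsInducedCycle G l1 ∧ IsInducedCycle G l2 ∧ Odd l1.length ∧ Odd l2.length ∧
    (∀ v : V, ¬ (v ∈ l1 ∧ v ∈ l2)) ∧
    (∀ x ∈ l1, ∀ y ∈ l2, ¬ G x y) ∧
    (∃ x ∈ l1, ∃ y ∈ l2, Reach G x y)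

/-- The semigroup `A_G`: integer vectors that are nonnegative rational combinations of
edge vectors of `G` (and lie in the lattice spanned by the edge vectors). -/
def AGset {V : Type*} [Fintype V] [DecidableEq V] (G : V → V → Prop) : Set (V → ℤ) :=
  {f | f ∈ AddSubgroup.closure {g : V → ℤ | ∃ x y, G x y ∧ g = eVec x y} ∧
    ∃ c : V × V → ℚ, (∀ e : V × V, 0 ≤ c e) ∧ (∀ e : V × V, c e ≠ 0 → G e.1 e.2) ∧
      (fun v => (f v : ℚ)) = ∑ e : V × V, c e • eVecQ e.1 e.2}

section EdgeMonoid

variable {V : Type*} [DecidableEq V]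

/-- The sum in `ℤV` of the vertices of a list, counted with multiplicity. -/
def vertexSum (l : List V) : V → ℤ :=
  (l.map fun v => (Pi.single v 1 : V → ℤ)).sum

@[simp] theorem vertexSum_nil : vertexSum ([] : List V) = 0 := rfl

@[simp] theorem vertexSum_cons (a : V) (l : List V) :
    vertexSum (a :: l) = Pi.single a 1 + vertexSum l := by
  simp [vertexSum]

@[simp] theorem vertexSum_append (l m : List V) :
    vertexSum (l ++ m) = vertexSum l + vertexSum m := by
  simp [vertexSum]

theorem eVec_eq_single_add_single (x y : V) :
    eVec x y = Pi.single x 1 + Pi.single y 1 := by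
  ext v; simp [eVec, Pi.single_apply]

theorem vertexSum_eq_ind {l : List V} (h : l.Nodup) : vertexSum l = ind l := by
  induction l with
  | nil => ext v; simp [ind]
  | cons a l ih =>
    rw [List.nodup_cons] at h
    rw [vertexSum_cons, ih h.2]
    ext v
    by_cases hv : v = a
    · subst hv; simp [ind, h.1]
    · simp [ind, hv]

/-- The monoid generated by the edge vectors. -/
def edgeMonoid (G : V → V → Prop) : AddSubmonoid (V → ℤ) :=
  AddSubmonoid.closure {g | ∃ x y, G x y ∧ g = eVec x y}

/-- The lattice generated by the edge vectors. -/
def edgeLattice (G : V → V → Prop) : AddSubgroup (V → ℤ) :=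
  AddSubgroup.closure {g | ∃ x y, G x y ∧ g = eVec x y}

variable {G : V → V → Prop}

theorem single_add_single_mem_edgeMonoid {x y : V} (h : G x y) :
    (Pi.single x 1 + Pi.single y 1 : V → ℤ) ∈ edgeMonoid G :=
  AddSubmonoid.subset_closure ⟨x, y, h, (eVec_eq_single_add_single x y).symm⟩

theorem mem_edgeLattice_of_mem_edgeMonoid {f : V → ℤ} (h : f ∈ edgeMonoid G) :
    f ∈ edgeLattice G :=
  (AddSubmonoid.closure_le (S := (edgeLattice G).toAddSubmonoid)).2
    (fun _ hg => AddSubgroup.subset_closure hg) h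

theorem vertexSum_mem_edgeMonoid_of_even {l : List V} (h : l.IsChain G)
    (hl : Even l.length) : vertexSum l ∈ edgeMonoid G := by
  induction l using List.twoStepInduction with
  | nil => simp [zero_mem]
  | singleton a => simp at hl
  | cons_cons a b l ih _ =>
    rw [vertexSum_cons, vertexSum_cons, ← add_assoc]
    refine add_mem (single_add_single_mem_edgeMonoid (List.isChain_cons_cons.1 h).1) (ih ?_ ?_)
    · exact (List.isChain_cons_cons.1 h).2.tail
    · simpa [Nat.even_add_one] using hl

end EdgeMonoid

section ClosedChain

variable {V : Type*} {G : V → V → Prop}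

theorem List.IsChain.segment {k l : List V} (h : l.IsChain G) (hk : k <:+: l) :
    k.IsChain G := by
  obtain ⟨A, B, rfl⟩ := hk
  exact h.left_of_append.right_of_append

/-- The list `l` is a closed walk when read cyclically; the empty list is allowed. -/
def ClosedChain (G : V → V → Prop) (l : List V) : Prop :=
  (l ++ l).IsChain G

theorem ClosedChain.isChain {l : List V} (h : ClosedChain G l) : l.IsChain G :=
  List.IsChain.left_of_append h

theorem ClosedChain.append_comm {l m : List V} (h : ClosedChain G (l ++ m)) :
    ClosedChain G (m ++ l) := by
  unfold ClosedChain at *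
  rcases eq_or_ne l [] with rfl | hl
  · simpa using h
  have h₁ : (m ++ l).IsChain G := h.segment ⟨l, m, by simp⟩
  have h₂ : (l ++ (m ++ l)).IsChain G := h.segment ⟨[], m, by simp⟩
  simpa using h₁.append_overlap h₂ hl

theorem closedChain_iff_isClosedWalk {l : List V} (hl : l ≠ []) :
    ClosedChain G l ↔ IsClosedWalk G l := by
  have hpos : 0 < l.length := List.length_pos_iff.2 hl
  unfold ClosedChain IsClosedWalk cnext
  rw [List.isChain_iff_getElem]
  simp only [hl, ne_eq, not_false_eq_true, true_and, List.get_eq_getElem]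
  constructor
  · intro h i
    have := h i (by simp; omega)
    by_cases hi : (i : ℕ) + 1 < l.length
    · simpa [List.getElem_append, Nat.mod_eq_of_lt hi, hi] using this
    · have hi' : (i : ℕ) + 1 = l.length := by omega
      simpa [List.getElem_append, hi'] using this
  · intro h i hi
    simp only [List.length_append] at hi
    have key (j k : ℕ) (hj : j < l.length) (hk : (j + 1) % l.length = k)
        (hk' : k < l.length) : G l[j] l[k] := by
      subst hk; exact h ⟨j, hj⟩
    rcases lt_trichotomy (i + 1) l.length with h1 | h1 | h1
    · simp only [List.getElem_append, h1, (by omega : i < l.length), dite_true]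
      exact key _ _ _ (Nat.mod_eq_of_lt h1) _
    · simp only [List.getElem_append, h1, (by omega : i < l.length), dite_true, lt_irrefl,
        dite_false]
      exact key _ _ _ (by simp [h1]) _
    · rw [List.getElem_append_right (by omega), List.getElem_append_right (by omega)]
      refine key _ _ (by omega) ?_ (by omega)
      rw [Nat.mod_eq_of_lt] <;> omega

theorem reach_of_isChain_cons {a b : V} {l : List V} (h : (a :: l).IsChain G) (hb : b ∈ l) :
    Reach G a b := by
  induction l generalizing a with
  | nil => simp at hb
  | cons c l ih =>
    rw [List.isChain_cons_cons] at h
    rcases List.mem_cons.1 hb with rfl | hb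
    · exact .single (.inl h.1)
    · exact .head (.inl h.1) (ih h.2 hb)

theorem ClosedChain.reach {a b : V} {l : List V} (h : ClosedChain G l) (ha : a ∈ l)
    (hb : b ∈ l) : Reach G a b := by
  obtain ⟨A, B, rfl⟩ := List.append_of_mem ha
  have h' := h.append_comm.isChain
  rw [List.cons_append] at h'
  rw [List.mem_append, List.mem_cons] at hb
  rcases hb with hb | rfl | hb
  · exact reach_of_isChain_cons h' (by simp [hb])
  · exact .refl
  · exact reach_of_isChain_cons h' (by simp [hb])

theorem reach_symm {a b : V} (h : Reach G a b) : Reach G b a := by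
  induction h with
  | refl => exact .refl
  | tail _ h ih => exact .head h.symm ih

theorem closedChain_cons_of_isChain {v : V} {l : List V} (h : (v :: l ++ [v]).IsChain G) :
    ClosedChain G (v :: l) := by
  have := h.append_overlap (l₃ := l) (h.segment ⟨[], [v], by simp⟩) (by simp)
  simpa [ClosedChain] using this

end ClosedChain

section InducedCycle

variable {V : Type*} [DecidableEq V] {G : V → V → Prop}

/-- `q` is an odd closed walk shorter than `l` whose removal from `l` leaves a sum of edges. -/
def Shortens (G : V → V → Prop) (l q : List V) : Prop :=
  ClosedChain G q ∧ Odd q.length ∧ q.length < l.length ∧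
    ∃ m ∈ edgeMonoid G, vertexSum l = m + vertexSum q

theorem exists_shortens_of_repeated {v : V} {A B C : List V}
    (h : ClosedChain G (A ++ v :: (B ++ v :: C)))
    (hl : Odd (A ++ v :: (B ++ v :: C)).length) :
    ∃ q, Shortens G (A ++ v :: (B ++ v :: C)) q := by
  simp only [List.length_append, List.length_cons] at hl
  unfold ClosedChain at h
  rcases Nat.even_or_odd B.length with hB | hB
  · refine ⟨v :: B, closedChain_cons_of_isChain (h.segment ⟨A, C ++ (A ++ v :: (B ++ v :: C)),
      by simp⟩), by simpa using hB.add_one, by simp; omega, vertexSum (v :: C ++ A),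
      vertexSum_mem_edgeMonoid_of_even (h.segment ⟨A ++ v :: B, v :: (B ++ v :: C), by simp⟩) ?_, ?_⟩
    · simp only [List.length_append, List.length_cons]; grind
    · simp; abel
  · refine ⟨v :: (C ++ A), closedChain_cons_of_isChain (h.segment ⟨A ++ v :: B, B ++ v :: C,
      by simp⟩), ?_, by simp; omega, vertexSum (v :: B),
      vertexSum_mem_edgeMonoid_of_even (h.segment ⟨A, v :: C ++ (A ++ v :: (B ++ v :: C)),
        by simp⟩) (by simpa using hB.add_one), ?_⟩
    · simp only [List.length_append, List.length_cons]; grind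
    · simp; abel

theorem exists_shortens_of_loop {a : V} {A B : List V} (ha : G a a)
    (h : ClosedChain G (A ++ a :: B)) (hl : Odd (A ++ a :: B).length) (hAB : B ++ A ≠ []) :
    ∃ q, Shortens G (A ++ a :: B) q := by
  unfold ClosedChain at h
  refine ⟨[a], by simpa [ClosedChain] using ha, by simp, ?_, vertexSum (B ++ A),
    vertexSum_mem_edgeMonoid_of_even (h.segment ⟨A ++ [a], a :: B, by simp⟩) ?_, ?_⟩
  · have := List.length_pos_iff.2 hAB
    simp at this ⊢; omega
  · simp only [List.length_append, List.length_cons] at hl ⊢; grind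
  · simp; abel

theorem exists_shortens_of_chord {a b : V} {A B C : List V} (hab : G a b) (hba : G b a)
    (h : ClosedChain G (A ++ a :: (B ++ b :: C)))
    (hl : Odd (A ++ a :: (B ++ b :: C)).length) (hB : B ≠ []) (hCA : C ++ A ≠ []) :
    ∃ q, Shortens G (A ++ a :: (B ++ b :: C)) q := by
  have hB' := List.length_pos_iff.2 hB
  have hCA' := List.length_pos_iff.2 hCA
  simp only [List.length_append, List.length_cons] at hl hCA'
  unfold ClosedChain at h
  rcases Nat.even_or_odd B.length with hB | hB
  · refine ⟨a :: b :: (C ++ A), closedChain_cons_of_isChain ?_, ?_, by simp; omega, vertexSum B,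
      vertexSum_mem_edgeMonoid_of_even (h.segment ⟨A ++ [a], b :: C ++ (A ++ a :: (B ++ b :: C)),
        by simp⟩) hB, ?_⟩
    · simp only [List.cons_append, List.isChain_cons_cons]
      exact ⟨hab, h.segment ⟨A ++ a :: B, B ++ b :: C, by simp⟩⟩
    · simp only [List.length_append, List.length_cons]; grind
    · simp; abel
  · refine ⟨a :: (B ++ [b]), closedChain_cons_of_isChain ?_, ?_, by simp; omega,
      vertexSum (C ++ A), vertexSum_mem_edgeMonoid_of_even
        (h.segment ⟨A ++ a :: (B ++ [b]), a :: (B ++ b :: C), by simp⟩) ?_, ?_⟩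
    · have h₁ : (a :: B ++ [b]).IsChain G := h.segment ⟨A, C ++ (A ++ a :: (B ++ b :: C)), by simp⟩
      simpa using h₁.append_overlap (l₃ := [a]) (by simpa using hba) (by simp)
    · simp only [List.length_append, List.length_cons, List.length_nil]; grind
    · simp only [List.length_append]; grind
    · simp; abel

theorem exists_isInducedCycle (hG : Symmetric G) (l : List V) (h : ClosedChain G l)
    (hl : Odd l.length) :
    ∃ m ∈ edgeMonoid G, ∃ q, IsInducedCycle G q ∧ Odd q.length ∧
      vertexSum l = m + vertexSum q := by
  induction hn : l.length using Nat.strong_induction_on generalizing l with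
  | _ n ih =>
    subst hn
    by_cases hq : ∃ q, Shortens G l q
    · obtain ⟨q, hq, hq', hlt, m, hm, he⟩ := hq
      obtain ⟨m', hm', r, hr, hr', he'⟩ := ih _ hlt q hq hq' rfl
      exact ⟨m + m', add_mem hm hm', r, hr, hr', by rw [he, he', add_assoc]⟩
    have ne : l ≠ [] := by rintro rfl; simp at hl
    refine ⟨0, zero_mem _, l, ⟨(closedChain_iff_isClosedWalk ne).1 h, ?_, ?_⟩, hl, by simp⟩
    · rw [List.nodup_iff_sublist]
      intro v hv
      obtain ⟨r, s, rfl, hr, hs⟩ := List.cons_sublist_iff.1 hv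
      obtain ⟨A, B, rfl⟩ := List.append_of_mem hr
      obtain ⟨B', C, rfl⟩ := List.append_of_mem (List.singleton_sublist.1 hs)
      have e : A ++ v :: B ++ (B' ++ v :: C) = A ++ v :: ((B ++ B') ++ v :: C) := by simp
      rw [e] at h hl hq
      exact hq (exists_shortens_of_repeated h hl)
    · have ordered {a b : V} {A B C : List V} (hab : G a b)
          (e : l = A ++ a :: (B ++ b :: C)) :
          ∃ i : Fin l.length,
            (a = l.get i ∧ b = cnext l i) ∨ (b = l.get i ∧ a = cnext l i) := by
        subst e
        by_cases hB : B = []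
        · subst hB
          refine ⟨⟨A.length, by simp⟩, .inl ⟨by simp, ?_⟩⟩
          simp [cnext, Nat.mod_eq_of_lt]
        by_cases hCA : C ++ A = []
        · obtain ⟨rfl, rfl⟩ := List.append_eq_nil_iff.1 hCA
          refine ⟨⟨B.length + 1, by simp⟩, .inr ⟨by simp, ?_⟩⟩
          simp [cnext]
        · exact absurd (exists_shortens_of_chord hab (hG hab) h hl hB hCA) hq
      intro a ha b hb hab
      obtain ⟨A, B, e⟩ := List.append_of_mem ha
      have hb' := hb
      rw [e, List.mem_append, List.mem_cons] at hb'
      rcases hb' with hb' | rfl | hb'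
      · obtain ⟨A, C, rfl⟩ := List.append_of_mem hb'
        obtain ⟨i, hi⟩ := ordered (A := A) (B := C) (C := B) (hG hab) (by simp [e])
        exact ⟨i, hi.symm⟩
      · subst e
        by_cases hBA : B ++ A = []
        · obtain ⟨rfl, rfl⟩ := List.append_eq_nil_iff.1 hBA
          exact ⟨⟨0, by simp⟩, by simp [cnext]⟩
        · exact absurd (exists_shortens_of_loop hab h hl hBA) hq
      · obtain ⟨B, C, rfl⟩ := List.append_of_mem hb'
        exact ordered hab e

theorem vertexSum_add_self_mem_edgeMonoid {l : List V} (h : ClosedChain G l) :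
    vertexSum l + vertexSum l ∈ edgeMonoid G := by
  rw [← vertexSum_append]
  exact vertexSum_mem_edgeMonoid_of_even h (by simp)

/-- An odd closed walk through `a` is a sum of edges apart from `a`. -/
theorem exists_vertexSum_eq_single_add {l : List V} (h : ClosedChain G l) (hl : Odd l.length)
    {a : V} (ha : a ∈ l) :
    ∃ m ∈ edgeMonoid G, vertexSum l = Pi.single a 1 + m := by
  obtain ⟨A, B, rfl⟩ := List.append_of_mem ha
  unfold ClosedChain at h
  refine ⟨vertexSum (B ++ A),
    vertexSum_mem_edgeMonoid_of_even (h.segment ⟨A ++ [a], a :: B, by simp⟩) ?_, ?_⟩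
  · simp only [List.length_append, List.length_cons] at hl ⊢; grind
  · simp; abel

theorem vertexSum_add_mem_of_adj {k l : List V} (hk : ClosedChain G k) (hl : ClosedChain G l)
    (hk' : Odd k.length) (hl' : Odd l.length) {a b : V} (ha : a ∈ k) (hb : b ∈ l)
    (hab : G a b) : vertexSum k + vertexSum l ∈ edgeMonoid G := by
  obtain ⟨m, hm, e⟩ := exists_vertexSum_eq_single_add hk hk' ha
  obtain ⟨m', hm', e'⟩ := exists_vertexSum_eq_single_add hl hl' hb
  rw [e, e', add_add_add_comm]
  exact add_mem (single_add_single_mem_edgeMonoid hab) (add_mem hm hm')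

theorem vertexSum_add_mem_of_mem {k l : List V} (hk : ClosedChain G k) (hl : ClosedChain G l)
    (hk' : Odd k.length) (hl' : Odd l.length) {a : V} (ha : a ∈ k) (hb : a ∈ l) :
    vertexSum k + vertexSum l ∈ edgeMonoid G := by
  obtain ⟨A, B, rfl⟩ := List.append_of_mem ha
  obtain ⟨C, D, rfl⟩ := List.append_of_mem hb
  have h₁ := hk.append_comm
  have h₂ := hl.append_comm
  have h₃ : (a :: B ++ A ++ [a]).IsChain G := List.IsChain.segment h₁ ⟨[], B ++ A, by simp⟩
  have h₄ := h₃.append_overlap (l₃ := D ++ C) h₂.isChain (by simp)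
  have := vertexSum_mem_edgeMonoid_of_even h₄ (by simp at *; grind)
  convert this using 1
  simp; abel

theorem vertexSum_add_mem_closure_of_reach {k l : List V} (hk : IsInducedCycle G k)
    (hl : IsInducedCycle G l) (hk' : Odd k.length) (hl' : Odd l.length) {a b : V}
    (ha : a ∈ k) (hb : b ∈ l) (hab : Reach G a b) :
    vertexSum k + vertexSum l ∈ AddSubmonoid.closure
      ({g : V → ℤ | ∃ x y, G x y ∧ g = eVec x y} ∪
       {g : V → ℤ | ∃ l1 l2 : List V, ExcPair G l1 l2 ∧ g = ind l1 + ind l2}) := by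
  have ck := (closedChain_iff_isClosedWalk hk.1.1).2 hk.1
  have cl := (closedChain_iff_isClosedWalk hl.1.1).2 hl.1
  by_cases h₁ : ∃ v, v ∈ k ∧ v ∈ l
  · obtain ⟨v, hv, hv'⟩ := h₁
    exact AddSubmonoid.closure_mono Set.subset_union_left
      (vertexSum_add_mem_of_mem ck cl hk' hl' hv hv')
  by_cases h₂ : ∃ x ∈ k, ∃ y ∈ l, G x y
  · obtain ⟨x, hx, y, hy, hxy⟩ := h₂
    exact AddSubmonoid.closure_mono Set.subset_union_left
      (vertexSum_add_mem_of_adj ck cl hk' hl' hx hy hxy)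
  · push Not at h₁ h₂
    rw [vertexSum_eq_ind hk.2.1, vertexSum_eq_ind hl.2.1]
    exact AddSubmonoid.subset_closure (.inr ⟨k, l, ⟨hk, hl, hk', hl',
      fun v hv => h₁ v hv.1 hv.2, h₂, a, ha, b, hb, hab⟩, rfl⟩)

end InducedCycle

section OddDecomposition

variable {V : Type*} [DecidableEq V] {G : V → V → Prop}

/-- The monoid generated by the edge vectors and the vectors of odd closed walks. -/
def oddMonoid (G : V → V → Prop) : AddSubmonoid (V → ℤ) :=
  AddSubmonoid.closure ({g | ∃ x y, G x y ∧ g = eVec x y} ∪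
    {g | ∃ l, ClosedChain G l ∧ Odd l.length ∧ g = vertexSum l})

theorem vertexSum_mem_oddMonoid {l : List V} (h : ClosedChain G l) :
    vertexSum l ∈ oddMonoid G := by
  rcases Nat.even_or_odd l.length with hl | hl
  · exact AddSubmonoid.closure_mono Set.subset_union_left
      (vertexSum_mem_edgeMonoid_of_even h.isChain hl)
  · exact AddSubmonoid.subset_closure (.inr ⟨l, h, hl, rfl⟩)

theorem sum_single_mem_oddMonoid {S : Type*} [Finite S] {σ : S → S} (hσ : σ.Injective)
    {π : S → V} (h : ∀ s, G (π s) (π (σ s))) (T : Finset S) (hT : ∀ s ∈ T, σ s ∈ T) :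
    ∑ s ∈ T, (Pi.single (π s) 1 : V → ℤ) ∈ oddMonoid G := by
  classical
  induction T using Finset.strongInduction with
  | H T ih =>
    rcases T.eq_empty_or_nonempty with rfl | ⟨s, hs⟩
    · simp [zero_mem]
    have hn : 0 < σ.minimalPeriod s :=
      Function.minimalPeriod_pos_of_mem_periodicPts (hσ.mem_periodicPts s)
    set n := σ.minimalPeriod s with hn_def
    set O : Finset S := (Finset.range n).image fun i => σ^[i] s with hO
    have memO (j : ℕ) : σ^[j] s ∈ O := by
      rw [hO, Finset.mem_image]
      exact ⟨j % n, Finset.mem_range.2 (Nat.mod_lt _ hn), Function.iterate_mod_minimalPeriod_eq⟩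
    have memT (j : ℕ) : σ^[j] s ∈ T := by
      induction j with
      | zero => exact hs
      | succ j ihj => rw [Function.iterate_succ_apply']; exact hT _ ihj
    have hOT : O ⊆ T := by
      intro t ht
      obtain ⟨i, -, rfl⟩ := Finset.mem_image.1 ht
      exact memT i
    have back (t : S) (ht : σ t ∈ O) : t ∈ O := by
      obtain ⟨i, -, hi⟩ := Finset.mem_image.1 ht
      have : σ (σ^[i + n - 1] s) = σ t := by
        rw [← Function.iterate_succ_apply' σ, show (i + n - 1).succ = i + n by omega,
          Function.iterate_add_minimalPeriod_eq]
        exact hi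
      rw [← hσ this]
      exact memO _
    rw [← Finset.sum_sdiff hOT]
    refine add_mem (ih _ (Finset.sdiff_ssubset hOT ⟨s, memO 0⟩) fun t ht => ?_) ?_
    · rw [Finset.mem_sdiff] at ht ⊢
      exact ⟨hT t ht.1, fun h' => ht.2 (back t h')⟩
    · have hinj : Set.InjOn (fun i => σ^[i] s) (Finset.range n : Set ℕ) := by
        intro i hi j hj hij
        rw [Finset.coe_range, Set.mem_Iio] at hi hj
        exact Function.iterate_injOn_Iio_minimalPeriod hi hj hij
      rw [hO, Finset.sum_image hinj]
      have hl : ∑ i ∈ Finset.range n, (Pi.single (π (σ^[i] s)) 1 : V → ℤ) =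
          vertexSum ((List.range n).map fun i => π (σ^[i] s)) := by
        rw [vertexSum, List.map_map]
        rfl
      rw [hl]
      refine vertexSum_mem_oddMonoid ?_
      have hd : (List.range n).map (fun i => π (σ^[i] s)) ++
          (List.range n).map (fun i => π (σ^[i] s)) =
            (List.range (n + n)).map fun i => π (σ^[i] s) := by
        rw [List.range_add, List.map_append, List.map_map]
        congr 1
        refine List.map_congr_left fun i _ => ?_
        simp only [Function.comp]
        rw [add_comm, Function.iterate_add_minimalPeriod_eq]
      unfold ClosedChain
      rw [hd, List.isChain_iff_getElem]
      intro i hi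
      simp only [List.getElem_map, List.getElem_range]
      rw [Function.iterate_succ_apply']
      exact h _

theorem exists_injective_of_row_sums [Fintype V] {n : V → ℕ} {B : V → V → ℚ}
    (hB : ∀ v w, 0 ≤ B v w) (hBG : ∀ v w, B v w ≠ 0 → G v w)
    (hBs : ∀ v w, B v w = B w v) (hn : ∀ v, (n v : ℚ) = ∑ w, B v w) :
    ∃ σ : (Σ v, Fin (n v)) → (Σ v, Fin (n v)), σ.Injective ∧ ∀ s, G s.1 (σ s).1 := by
  classical
  suffices hall : _ by
    obtain ⟨σ, hσ, h⟩ := (Finset.all_card_le_biUnion_card_iff_exists_injective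
      (fun s : Σ v, Fin (n v) =>
        (Finset.univ.filter fun t : Σ v, Fin (n v) => G s.1 t.1))).1 hall
    exact ⟨σ, hσ, fun s => by simpa using h s⟩
  intro A
  set A' : Finset V := A.image Sigma.fst
  set N : Finset V := Finset.univ.filter fun w => ∃ v ∈ A', G v w
  have h₁ : A.card ≤ ∑ v ∈ A', n v := by
    have : A ⊆ A'.sigma fun _ => Finset.univ := fun s hs =>
      Finset.mem_sigma.2 ⟨Finset.mem_image_of_mem Sigma.fst hs, Finset.mem_univ _⟩
    simpa using Finset.card_le_card this
  have h₂ : (A.biUnion fun s : Σ v, Fin (n v) =>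
      (Finset.univ.filter fun t : Σ v, Fin (n v) => G s.1 t.1)) =
        N.sigma fun _ => Finset.univ := by
    ext t
    simp [N, A']
  rw [h₂, Finset.card_sigma]
  simp only [Finset.card_univ, Fintype.card_fin]
  refine h₁.trans ?_
  rw [← Nat.cast_le (α := ℚ)]
  push_cast
  calc ∑ v ∈ A', (n v : ℚ) = ∑ v ∈ A', ∑ w ∈ N, B v w := by
        refine Finset.sum_congr rfl fun v hv => ?_
        rw [hn, ← Finset.sum_subset (Finset.subset_univ N)]
        intro w _ hw
        by_contra hne
        exact hw (Finset.mem_filter.2 ⟨Finset.mem_univ _, v, hv, hBG _ _ hne⟩)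
    _ = ∑ w ∈ N, ∑ v ∈ A', B v w := Finset.sum_comm
    _ ≤ ∑ w ∈ N, ∑ v, B v w := Finset.sum_le_sum fun w _ =>
        Finset.sum_le_sum_of_subset_of_nonneg (Finset.subset_univ _) fun v _ _ => hB v w
    _ = ∑ w ∈ N, (n w : ℚ) := Finset.sum_congr rfl fun w _ => by
        rw [hn]; exact Finset.sum_congr rfl fun v _ => hBs v w

theorem sum_smul_eVecQ_apply [Fintype V] (c : V × V → ℚ) (v : V) :
    (∑ e : V × V, c e • eVecQ e.1 e.2) v = ∑ w, (c (v, w) + c (w, v)) := by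
  simp [Finset.sum_apply, eVecQ, mul_add, Finset.sum_add_distrib, Fintype.sum_prod_type]
  rw [Finset.sum_comm]
  simp

theorem mem_oddMonoid_of_cone [Fintype V] (hG : Symmetric G) {f : V → ℤ} {c : V × V → ℚ}
    (hc : ∀ e, 0 ≤ c e) (hcG : ∀ e, c e ≠ 0 → G e.1 e.2)
    (hf : (fun v => (f v : ℚ)) = ∑ e : V × V, c e • eVecQ e.1 e.2) : f ∈ oddMonoid G := by
  have hf' (v : V) : (f v : ℚ) = ∑ w, (c (v, w) + c (w, v)) := by
    rw [← sum_smul_eVecQ_apply, ← hf]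
  have hpos (v : V) : 0 ≤ f v := by
    rw [← Int.cast_nonneg_iff (R := ℚ), hf']
    exact Finset.sum_nonneg fun w _ => add_nonneg (hc _) (hc _)
  obtain ⟨n, rfl⟩ : ∃ n : V → ℕ, f = fun v => (n v : ℤ) :=
    ⟨fun v => (f v).toNat, funext fun v => by simp [hpos v]⟩
  have hBG (v w : V) (hne : c (v, w) + c (w, v) ≠ 0) : G v w := by
    by_cases h₁ : c (v, w) = 0
    · exact hG (hcG (w, v) fun h₂ => hne (by simp [h₁, h₂]))
    · exact hcG _ h₁
  obtain ⟨σ, hσ, h⟩ := exists_injective_of_row_sums (n := n)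
    (B := fun v w => c (v, w) + c (w, v)) (fun v w => add_nonneg (hc _) (hc _)) hBG
    (fun v w => add_comm _ _) (fun v => by simpa using hf' v)
  have := sum_single_mem_oddMonoid hσ (π := Sigma.fst) h Finset.univ (by simp)
  convert this using 1
  ext v
  simp only [Finset.sum_apply, Fintype.sum_sigma, Pi.single_apply]
  rw [Finset.sum_eq_single v]
  · simp
  · intro w _ hw; simp [hw.symm]
  · simp

theorem exists_list_of_mem_oddMonoid (hG : Symmetric G) {f : V → ℤ} (hf : f ∈ oddMonoid G) :
    ∃ m ∈ edgeMonoid G, ∃ L : List (List V),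
      (∀ l ∈ L, IsInducedCycle G l ∧ Odd l.length) ∧ f = m + (L.map vertexSum).sum := by
  induction hf using AddSubmonoid.closure_induction with
  | mem g hg =>
    rcases hg with hg | ⟨l, hl, hl', rfl⟩
    · exact ⟨g, AddSubmonoid.subset_closure hg, [], by simp, by simp⟩
    · obtain ⟨m, hm, q, hq, hq', e⟩ := exists_isInducedCycle hG l hl hl'
      exact ⟨m, hm, [q], by simp [hq, hq'], by simp [e]⟩
  | zero => exact ⟨0, zero_mem _, [], by simp, by simp⟩
  | add f g _ _ hf hg =>
    obtain ⟨m, hm, L, hL, rfl⟩ := hf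
    obtain ⟨m', hm', L', hL', rfl⟩ := hg
    refine ⟨m + m', add_mem hm hm', L ++ L', fun l hl => ?_, by simp; abel⟩
    exact (List.mem_append.1 hl).elim (hL l) (hL' l)

end OddDecomposition

section Lattice

variable {V : Type*} [DecidableEq V] {G : V → V → Prop}

theorem mem_edgeLattice_of_reach {a b : V} (h : Reach G a b) :
    (Pi.single a 1 + Pi.single b 1 : V → ℤ) ∈ edgeLattice G ∨
      (Pi.single a 1 - Pi.single b 1 : V → ℤ) ∈ edgeLattice G := by
  induction h with
  | refl => right; simp [zero_mem]
  | @tail b c _ hbc ih =>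
    have hbc' : (Pi.single b 1 + Pi.single c 1 : V → ℤ) ∈ edgeLattice G := by
      rcases hbc with h | h
      · exact mem_edgeLattice_of_mem_edgeMonoid (single_add_single_mem_edgeMonoid h)
      · rw [add_comm]
        exact mem_edgeLattice_of_mem_edgeMonoid (single_add_single_mem_edgeMonoid h)
    rcases ih with ih | ih
    · right; convert sub_mem ih hbc' using 1; abel
    · left; convert add_mem ih hbc' using 1; abel

theorem vertexSum_add_mem_edgeLattice {k l : List V} (hk : ClosedChain G k)
    (hl : ClosedChain G l) (hk' : Odd k.length) (hl' : Odd l.length) {a b : V} (ha : a ∈ k)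
    (hb : b ∈ l) (hab : Reach G a b) : vertexSum k + vertexSum l ∈ edgeLattice G := by
  obtain ⟨m, hm, e⟩ := exists_vertexSum_eq_single_add hk hk' ha
  obtain ⟨m', hm', e'⟩ := exists_vertexSum_eq_single_add hl hl' hb
  have h₁ := mem_edgeLattice_of_mem_edgeMonoid hm
  have h₂ := mem_edgeLattice_of_mem_edgeMonoid hm'
  rcases mem_edgeLattice_of_reach hab with h | h
  · rw [e, e', add_add_add_comm]
    exact add_mem h (add_mem h₁ h₂)
  · have h₃ := mem_edgeLattice_of_mem_edgeMonoid (vertexSum_add_self_mem_edgeMonoid hl)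
    have : vertexSum k + vertexSum l = (Pi.single a 1 - Pi.single b 1) + m - m' +
        (vertexSum l + vertexSum l) := by rw [e, e']; abel
    rw [this]
    exact add_mem (sub_mem (add_mem h h₁) h₂) h₃

end Lattice

section Parity

variable {V : Type*} [Fintype V] [DecidableEq V] {G : V → V → Prop}

open scoped Classical in
/-- The sum modulo two of the coordinates in the connected component of `x`. -/
noncomputable def componentParity (G : V → V → Prop) (x : V) : (V → ℤ) →+ ZMod 2 where
  toFun f := ∑ v, if Reach G x v then (f v : ZMod 2) else 0
  map_zero' := by simp
  map_add' f g := by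
    rw [← Finset.sum_add_distrib]
    refine Finset.sum_congr rfl fun v _ => ?_
    split_ifs <;> simp

open scoped Classical in
theorem componentParity_single (x v : V) :
    componentParity G x (Pi.single v 1) = if Reach G x v then 1 else 0 := by
  change (∑ w, if Reach G x w then (((Pi.single v 1 : V → ℤ) w : ℤ) : ZMod 2) else 0) = _
  rw [Finset.sum_eq_single v]
  · simp
  · intro w _ hw; simp [hw]
  · simp

theorem componentParity_eq_zero_of_mem_edgeLattice (x : V) {f : V → ℤ}
    (hf : f ∈ edgeLattice G) : componentParity G x f = 0 := by
  have : edgeLattice G ≤ (componentParity G x).ker := by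
    refine (AddSubgroup.closure_le _).2 ?_
    rintro _ ⟨a, b, hab, rfl⟩
    have hiff : Reach G x a ↔ Reach G x b :=
      ⟨fun h => h.tail (.inl hab), fun h => h.tail (.inr hab)⟩
    simp only [SetLike.mem_coe, AddMonoidHom.mem_ker, eVec_eq_single_add_single, map_add,
      componentParity_single]
    by_cases h : Reach G x a
    · rw [if_pos h, if_pos (hiff.1 h)]
      exact CharTwo.add_self_eq_zero 1
    · rw [if_neg h, if_neg (mt hiff.2 h), add_zero]
  exact this hf

theorem componentParity_vertexSum_of_reach {x : V} {l : List V} (h : ∀ v ∈ l, Reach G x v) :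
    componentParity G x (vertexSum l) = l.length := by
  induction l with
  | nil => simp
  | cons a l ih =>
    rw [List.forall_mem_cons] at h
    simp [componentParity_single, ih h.2, h.1, add_comm]

theorem componentParity_vertexSum_of_not_reach {x : V} {l : List V}
    (h : ∀ v ∈ l, ¬ Reach G x v) : componentParity G x (vertexSum l) = 0 := by
  induction l with
  | nil => simp
  | cons a l ih =>
    rw [List.forall_mem_cons] at h
    simp [componentParity_single, ih h.2, h.1]

end Parity

section Main

variable {V : Type*} [Fintype V] [DecidableEq V] {G : V → V → Prop}

theorem sum_vertexSum_mem_closure (n : ℕ) (L : List (List V)) (hn : L.length = n)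
    (hL : ∀ l ∈ L, IsInducedCycle G l ∧ Odd l.length)
    (hpar : ∀ x, componentParity G x (L.map vertexSum).sum = 0) :
    (L.map vertexSum).sum ∈ AddSubmonoid.closure
      ({g : V → ℤ | ∃ x y, G x y ∧ g = eVec x y} ∪
       {g : V → ℤ | ∃ l1 l2 : List V, ExcPair G l1 l2 ∧ g = ind l1 + ind l2}) := by
  induction n using Nat.strong_induction_on generalizing L with
  | _ n ih =>
    subst hn
    cases L with
    | nil => simp [zero_mem]
    | cons l L =>
      rw [List.forall_mem_cons] at hL
      obtain ⟨⟨hl, hl'⟩, hL⟩ := hL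
      have cl := (closedChain_iff_isClosedWalk hl.1.1).2 hl.1
      obtain ⟨x, hx⟩ := List.exists_mem_of_ne_nil l hl.1.1
      have hl₁ : componentParity G x (vertexSum l) = 1 := by
        rw [componentParity_vertexSum_of_reach fun v hv => cl.reach hx hv]
        exact ZMod.natCast_eq_one_iff_odd.2 hl'
      by_cases hk : ∃ k ∈ L, ∃ y ∈ k, Reach G x y
      · obtain ⟨k, hk, y, hy, hxy⟩ := hk
        obtain ⟨A, B, rfl⟩ := List.append_of_mem hk
        obtain ⟨hk₁, hk₂⟩ := hL k hk
        have ck := (closedChain_iff_isClosedWalk hk₁.1.1).2 hk₁.1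
        have e : ((l :: (A ++ k :: B)).map vertexSum).sum =
            (vertexSum l + vertexSum k) + ((A ++ B).map vertexSum).sum := by
          simp; abel
        rw [e]
        refine add_mem (vertexSum_add_mem_closure_of_reach hl hk₁ hl' hk₂ hx hy hxy)
          (ih _ (by simp) _ rfl (fun l hl => hL l ?_) fun z => ?_)
        · simp only [List.mem_append, List.mem_cons] at hl ⊢; tauto
        · have h₀ : componentParity G z (vertexSum l + vertexSum k) = 0 := by
            by_cases hz : Reach G z x
            · rw [map_add,
                componentParity_vertexSum_of_reach fun v hv => hz.trans (cl.reach hx hv),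
                componentParity_vertexSum_of_reach fun v hv =>
                  (hz.trans hxy).trans (ck.reach hy hv),
                ← Nat.cast_add]
              exact ZMod.natCast_eq_zero_iff_even.2 (hl'.add_odd hk₂)
            · rw [map_add,
                componentParity_vertexSum_of_not_reach fun v hv h =>
                  hz (h.trans (cl.reach hv hx)),
                componentParity_vertexSum_of_not_reach fun v hv h =>
                  hz ((h.trans (ck.reach hv hy)).trans (reach_symm hxy)), add_zero]
          have := hpar z
          rwa [e, map_add, h₀, zero_add] at this
      · push Not at hk
        have h₀ : componentParity G x (L.map vertexSum).sum = 0 := by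
          rw [map_list_sum, List.map_map]
          refine List.sum_eq_zero fun a ha => ?_
          obtain ⟨k, hk', rfl⟩ := List.mem_map.1 ha
          exact componentParity_vertexSum_of_not_reach (hk k hk')
        have := hpar x
        rw [List.map_cons, List.sum_cons, map_add, hl₁, h₀] at this
        exact absurd this (by decide)

/-- The integer vectors in the rational cone spanned by the edge vectors. -/
def edgeCone (G : V → V → Prop) : AddSubmonoid (V → ℤ) where
  carrier := {f | ∃ c : V × V → ℚ, (∀ e : V × V, 0 ≤ c e) ∧
    (∀ e : V × V, c e ≠ 0 → G e.1 e.2) ∧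
      (fun v => (f v : ℚ)) = ∑ e : V × V, c e • eVecQ e.1 e.2}
  zero_mem' := ⟨0, by simp, by simp, by ext; simp⟩
  add_mem' := by
    rintro f g ⟨c, hc, hcG, hf⟩ ⟨d, hd, hdG, hg⟩
    refine ⟨c + d, fun e => add_nonneg (hc e) (hd e), fun e he => ?_, ?_⟩
    · by_cases h : c e = 0
      · exact hdG e fun h' => he (by simp [h, h'])
      · exact hcG e h
    · simp only [Pi.add_apply, add_smul, Finset.sum_add_distrib, ← hf, ← hg]
      ext v; simp

theorem edgeMonoid_le_edgeCone : edgeMonoid G ≤ edgeCone G := by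
  refine AddSubmonoid.closure_le.2 ?_
  rintro _ ⟨x, y, hxy, rfl⟩
  refine ⟨Pi.single (x, y) 1, fun e => ?_, fun e he => ?_, ?_⟩
  · by_cases h : e = (x, y) <;> simp [h]
  · by_cases h : e = (x, y)
    · subst h; exact hxy
    · simp [h] at he
  · rw [Finset.sum_eq_single (x, y)]
    · ext v; simp [eVec, eVecQ]
    · intro e _ he; simp [he]
    · simp

theorem mem_edgeCone_of_add_self {f : V → ℤ} (h : f + f ∈ edgeCone G) : f ∈ edgeCone G := by
  obtain ⟨c, hc, hcG, hf⟩ := h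
  refine ⟨(2⁻¹ : ℚ) • c, fun e => ?_, fun e he => hcG e fun h => he (by simp [h]), ?_⟩
  · simpa using hc e
  · simp only [Pi.smul_apply, smul_assoc, ← Finset.smul_sum, ← hf]
    ext v; simp; ring

end Main

/-- `A_G` is generated, as an additive monoid, by the edge vectors of `G` together with
the characteristic vectors of the exceptional pairs of `G`. -/
theorem stmt9 {V : Type*} [Fintype V] [DecidableEq V] (G : V → V → Prop)
    (hG : Symmetric G) :
    AGset G = (AddSubmonoid.closure
      ({g : V → ℤ | ∃ x y, G x y ∧ g = eVec x y} ∪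
       {g : V → ℤ | ∃ l1 l2 : List V, ExcPair G l1 l2 ∧ g = ind l1 + ind l2}) :
        AddSubmonoid (V → ℤ)) := by
  ext f
  constructor
  · rintro ⟨hf, c, hc, hcG, hfc⟩
    obtain ⟨m, hm, L, hL, rfl⟩ :=
      exists_list_of_mem_oddMonoid hG (mem_oddMonoid_of_cone hG hc hcG hfc)
    refine add_mem (AddSubmonoid.closure_mono Set.subset_union_left hm)
      (sum_vertexSum_mem_closure _ L rfl hL fun x => ?_)
    have h := componentParity_eq_zero_of_mem_edgeLattice x hf
    rwa [map_add, componentParity_eq_zero_of_mem_edgeLattice x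
      (mem_edgeLattice_of_mem_edgeMonoid hm), zero_add] at h
  · intro hf
    suffices h : AddSubmonoid.closure
        ({g : V → ℤ | ∃ x y, G x y ∧ g = eVec x y} ∪
         {g : V → ℤ | ∃ l1 l2 : List V, ExcPair G l1 l2 ∧ g = ind l1 + ind l2}) ≤
        (edgeLattice G).toAddSubmonoid ⊓ edgeCone G from h hf
    refine AddSubmonoid.closure_le.2 ?_
    rintro g (hg | ⟨k, l, ⟨hk, hl, hk', hl', -, -, x, hx, y, hy, hxy⟩, rfl⟩)
    · exact ⟨AddSubgroup.subset_closure hg,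
        edgeMonoid_le_edgeCone (AddSubmonoid.subset_closure hg)⟩
    · have ck := (closedChain_iff_isClosedWalk hk.1.1).2 hk.1
      have cl := (closedChain_iff_isClosedWalk hl.1.1).2 hl.1
      rw [← vertexSum_eq_ind hk.2.1, ← vertexSum_eq_ind hl.2.1]
      exact ⟨vertexSum_add_mem_edgeLattice ck cl hk' hl' hx hy hxy, add_mem
        (mem_edgeCone_of_add_self
          (edgeMonoid_le_edgeCone (vertexSum_add_self_mem_edgeMonoid ck)))
        (mem_edgeCone_of_add_self
          (edgeMonoid_le_edgeCone (vertexSum_add_self_mem_edgeMonoid cl)))⟩
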